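/- There exists a sequence (f_n) of Boolean functions such that f_n and ¬f_n can both be represented by unambiguous nondeterministic OBDDs of size polynomial in n respecting a common variable ordering, while every nondeterministic OBDD representing f_n in which all nondeterministic nodes precede all decision nodes (i.e., all nondeterministic decisions are made at the beginning of every computation) has size 2^{Ω(n^ε)} for some constant ε > 0. -/

import Mathlib

namespace BDDPaper

/-- Labels of nodes in a (nondeterministic) binary decision diagram over
variables indexed by `Fin n`. -/
inductive BLabel (n : ℕ) where
  | decision (i : Fin n)
  | orNode
  | sink (b : Bool)
  deriving DecidableEq

/-- A nondeterministic binary decision diagram (with nodes listed in a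
topological order, i.e. all edges lead to nodes of larger index, which
encodes acyclicity). Decision nodes have the two successors `succ0`/`succ1`;
`∨`-nodes have the (unlabeled) successors `orSucc`. -/
structure NBDD (n : ℕ) where
  size : ℕ
  label : Fin size → BLabel n
  succ0 : Fin size → Fin size
  succ1 : Fin size → Fin size
  orSucc : Fin size → Finset (Fin size)
  source : Fin size
  succ0_lt : ∀ u i, label u = .decision i → u < succ0 u
  succ1_lt : ∀ u i, label u = .decision i → u < succ1 u
  orSucc_lt : ∀ u v, label u = .orNode → v ∈ orSucc u → u < v

namespace NBDD

variable {n : ℕ} (G : NBDD n)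

/-- The edge relation of the diagram. -/
def Edge (u v : Fin G.size) : Prop :=
  (∃ i, G.label u = .decision i ∧ (v = G.succ0 u ∨ v = G.succ1 u)) ∨
  (G.label u = .orNode ∧ v ∈ G.orSucc u)

/-- The edges activated by an input `b`. -/
def Active (b : Fin n → Bool) (u v : Fin G.size) : Prop :=
  (∃ i, G.label u = .decision i ∧ v = (if b i then G.succ1 u else G.succ0 u)) ∨
  (G.label u = .orNode ∧ v ∈ G.orSucc u)

/-- `p` is a path of edges activated by `b` starting at node `s`. -/
def IsPathFrom (b : Fin n → Bool) (s : Fin G.size) (p : List (Fin G.size)) : Prop :=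
  p.head? = some s ∧ List.Chain' (G.Active b) p

/-- The path `p` ends in the 1-sink. -/
def EndsAccepting (p : List (Fin G.size)) : Prop :=
  ∃ v, p.getLast? = some v ∧ G.label v = .sink true

/-- There is a path of edges activated by `b` from `s` to the 1-sink. -/
def AcceptsFrom (b : Fin n → Bool) (s : Fin G.size) : Prop :=
  ∃ p, G.IsPathFrom b s p ∧ G.EndsAccepting p

/-- `p` is an accepting path for the input `b`. -/
def AcceptingPath (b : Fin n → Bool) (p : List (Fin G.size)) : Prop :=
  G.IsPathFrom b G.source p ∧ G.EndsAccepting p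

/-- The diagram accepts the input `b`. -/
def Accepts (b : Fin n → Bool) : Prop := ∃ p, G.AcceptingPath b p

/-- The diagram represents the Boolean function `f`. -/
def Represents (f : (Fin n → Bool) → Bool) : Prop :=
  ∀ b, f b = true ↔ G.Accepts b

/-- The diagram is unambiguous nondeterministic: every input has at most one
accepting path. -/
def Unambiguous : Prop :=
  ∀ b p q, G.AcceptingPath b p → G.AcceptingPath b q → p = q

/-- The diagram is deterministic, i.e. an ordinary BDD: it has no `∨`-nodes. -/
def Deterministic : Prop := ∀ u, G.label u ≠ .orNode

/-- The diagram respects the variable ordering given by the strict order `r`: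
along every directed path the labels of the decision nodes form a subsequence
of the ordering, i.e. they strictly increase w.r.t. `r`. -/
def IsOBDDRel (r : Fin n → Fin n → Prop) : Prop :=
  ∀ u v i j, Relation.TransGen G.Edge u v →
    G.label u = .decision i → G.label v = .decision j → r i j

/-- The diagram is ordered w.r.t. the variable ordering `π` (position `p` of the
ordering holds the variable `π p`). -/
def IsOBDD (π : Equiv.Perm (Fin n)) : Prop :=
  G.IsOBDDRel fun i j => π.symm i < π.symm j

/-- Free BDD condition: on every directed path every variable is tested at most
once. -/
def IsFBDD : Prop :=
  ∀ u v i j, Relation.TransGen G.Edge u v →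
    G.label u = .decision i → G.label v = .decision j → i ≠ j

/-- `u` is an internal node (not a sink). -/
def IsInternal (u : Fin G.size) : Prop := ∀ c : Bool, G.label u ≠ .sink c

/-- The set of variables appearing (as decision-node labels) in the subgraph
rooted at `u`. -/
def varsAt (u : Fin G.size) : Set (Fin n) :=
  {i | ∃ v, Relation.ReflTransGen G.Edge u v ∧ G.label v = .decision i}

end NBDD

end BDDPaper
namespace BDDPaper

/-- In `G`, all nondeterministic nodes precede all decision nodes: no edge
leads from a non-`∨`-node to an `∨`-node, i.e. all nondeterministic decisions
are made at the beginning of every computation. -/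
def NBDD.OrNodesFirst {n : ℕ} (G : NBDD n) : Prop :=
  ∀ u v, G.Edge u v → G.label v = .orNode → G.label u = .orNode

namespace NBDD

variable {n : ℕ} (G : NBDD n)

theorem acceptsFrom_iff_reflTransGen {b : Fin n → Bool} {s : Fin G.size} :
    G.AcceptsFrom b s ↔
      ∃ v, Relation.ReflTransGen (G.Active b) s v ∧ G.label v = .sink true := by
  constructor
  · rintro ⟨p, ⟨hs, hc⟩, v, hv, hl⟩
    refine ⟨v, ?_, hl⟩
    induction p generalizing s with
    | nil => simp at hs
    | cons a l ih =>
      obtain rfl : a = s := by simpa using hs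
      cases l with
      | nil =>
        obtain rfl : a = v := by simpa using hv
        exact .refl
      | cons c l =>
        have hc' := List.isChain_cons_cons.1 hc
        exact .head hc'.1 (ih (by simp) hc'.2 (by simpa using hv))
  · rintro ⟨v, h, hl⟩
    induction h using Relation.ReflTransGen.head_induction_on with
    | refl => exact ⟨[v], ⟨rfl, List.isChain_singleton _⟩, v, rfl, hl⟩
    | head h _ ih =>
      obtain ⟨p, ⟨hs, hc⟩, w, hw, hl'⟩ := ih
      cases p with
      | nil => simp at hs
      | cons a l =>
        obtain rfl : a = _ := by simpa using hs
        exact ⟨_ :: a :: l, ⟨rfl, List.isChain_cons_cons.2 ⟨h, hc⟩⟩, w, by simpa using hw, hl'⟩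

theorem acceptsFrom_iff {b : Fin n → Bool} {s : Fin G.size} :
    G.AcceptsFrom b s ↔
      G.label s = .sink true ∨ ∃ v, G.Active b s v ∧ G.AcceptsFrom b v := by
  simp only [acceptsFrom_iff_reflTransGen]
  constructor
  · rintro ⟨v, h, hl⟩
    rcases h.cases_head with rfl | ⟨w, hw, h⟩
    · exact .inl hl
    · exact .inr ⟨w, hw, v, h, hl⟩
  · rintro (hl | ⟨w, hw, v, h, hl⟩)
    · exact ⟨s, .refl, hl⟩
    · exact ⟨v, .head hw h, hl⟩

theorem not_active_of_sink {b : Fin n → Bool} {u v : Fin G.size} {c : Bool}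
    (hu : G.label u = .sink c) : ¬ G.Active b u v := by
  rintro (⟨i, hi, _⟩ | ⟨ho, _⟩) <;> simp_all

theorem active_decision_iff {b : Fin n → Bool} {u v : Fin G.size} {i : Fin n}
    (hu : G.label u = .decision i) :
    G.Active b u v ↔ v = if b i then G.succ1 u else G.succ0 u := by
  simp [Active, hu]

theorem active_or_iff {b : Fin n → Bool} {u v : Fin G.size}
    (hu : G.label u = .orNode) : G.Active b u v ↔ v ∈ G.orSucc u := by
  simp [Active, hu]

theorem Active.edge {G : NBDD n} {b : Fin n → Bool} {u v : Fin G.size}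
    (h : G.Active b u v) : G.Edge u v := by
  rcases h with ⟨i, hi, rfl⟩ | h
  · exact .inl ⟨i, hi, by split_ifs <;> simp⟩
  · exact .inr h

/-- A diagram is unambiguous as soon as every node has, for every input, at most one activated
successor from which the input is accepted. -/
theorem unambiguous_of_unique_succ
    (h : ∀ b u v v', G.Active b u v → G.Active b u v' →
      G.AcceptsFrom b v → G.AcceptsFrom b v' → v = v') : G.Unambiguous := by
  have key : ∀ (b : Fin n → Bool) (p q : List (Fin G.size)) (s : Fin G.size),
      G.IsPathFrom b s p → G.EndsAccepting p → G.IsPathFrom b s q → G.EndsAccepting q →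
        p = q := by
    intro b p
    induction p with
    | nil => rintro q s ⟨h, _⟩; simp at h
    | cons a l ih =>
      rintro q s ⟨hs, hc⟩ hp ⟨hs', hc'⟩ hq
      obtain rfl : a = s := by simpa using hs
      cases q with
      | nil => simp at hs'
      | cons a' l' =>
        obtain rfl : a' = a := by simpa using hs'
        congr 1
        cases l with
        | nil =>
          cases l' with
          | nil => rfl
          | cons c' l' =>
            obtain ⟨v, hv, hl⟩ := hp
            obtain rfl : a' = v := by simpa using hv
            exact absurd (List.isChain_cons_cons.1 hc').1 (G.not_active_of_sink hl)
        | cons c l =>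
          obtain ⟨hac, hcl⟩ := List.isChain_cons_cons.1 hc
          have hp' : G.EndsAccepting (c :: l) := by simpa [EndsAccepting] using hp
          cases l' with
          | nil =>
            obtain ⟨v, hv, hl⟩ := hq
            obtain rfl : a' = v := by simpa using hv
            exact absurd hac (G.not_active_of_sink hl)
          | cons c' l' =>
            obtain ⟨hac', hcl'⟩ := List.isChain_cons_cons.1 hc'
            have hq' : G.EndsAccepting (c' :: l') := by simpa [EndsAccepting] using hq
            obtain rfl : c = c' := h b _ c c' hac hac' ⟨_, ⟨rfl, hcl⟩, hp'⟩ ⟨_, ⟨rfl, hcl'⟩, hq'⟩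
            exact ih _ c ⟨rfl, hcl⟩ hp' ⟨rfl, hcl'⟩ hq'
  intro b p q hp hq
  exact key b p q G.source hp.1 hp.2 hq.1 hq.2

end NBDD

/-- The value of the bit of `b` with index `u`, and `false` when `u` is out of range. -/
def bit {n : ℕ} (b : Fin n → Bool) (u : ℕ) : Bool := if h : u < n then b ⟨u, h⟩ else false

/-- A nondeterministic machine that reads the input two bits at a time, in `steps` steps; each
step begins with a nondeterministic choice of a new state. -/
structure Machine (n : ℕ) (S : Type) where
  steps : ℕ
  two_mul_steps_le : 2 * steps ≤ n
  choices : ℕ → S → Finset S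
  step : ℕ → S → Bool → Bool → S
  start : S
  acc : S → Bool

namespace Machine

variable {n : ℕ} {S : Type} (M : Machine n S)

/-- Acceptance from the state `s` before step `q` when `r` steps remain. -/
def AcceptsIn (b : Fin n → Bool) : ℕ → ℕ → S → Prop
  | 0, _, s => M.acc s = true
  | r + 1, q, s => ∃ s' ∈ M.choices q s,
      AcceptsIn b r (q + 1) (M.step q s' (bit b (2 * q)) (bit b (2 * q + 1)))

/-- The label of a node in layer `k`. -/
def labelOf (v : Fin (3 * M.steps + 1) × (S × Bool)) : BLabel n :=
  have := M.two_mul_steps_le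
  if h : v.1.1 < 3 * M.steps then
    if v.1.1 % 3 = 0 then .orNode
    else if v.1.1 % 3 = 1 then .decision ⟨2 * (v.1.1 / 3), by omega⟩
    else .decision ⟨2 * (v.1.1 / 3) + 1, by omega⟩
  else .sink (M.acc v.2.1)

def nextLayer (k : Fin (3 * M.steps + 1)) : Fin (3 * M.steps + 1) :=
  ⟨min (k + 1) (3 * M.steps), by omega⟩

/-- The successor of a decision node along the edge labeled `x`. -/
def succOf (x : Bool) (v : Fin (3 * M.steps + 1) × (S × Bool)) :
    Fin (3 * M.steps + 1) × (S × Bool) :=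
  (M.nextLayer v.1,
    if v.1.1 % 3 = 1 then (v.2.1, x) else (M.step (v.1.1 / 3) v.2.1 v.2.2 x, false))

theorem lt_nextLayer_of_labelOf {v : Fin (3 * M.steps + 1) × (S × Bool)}
    (h : ∀ c, M.labelOf v ≠ .sink c) : v.1 < M.nextLayer v.1 := by
  have : v.1.1 < 3 * M.steps := by
    by_contra hv
    exact h (M.acc v.2.1) (by simp [labelOf, hv])
  rw [Fin.lt_def]
  simp only [nextLayer]
  omega

theorem layer_of_labelOf {v : Fin (3 * M.steps + 1) × (S × Bool)} {i : Fin n}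
    (h : M.labelOf v = .decision i) :
    v.1.1 = 3 * (i.1 / 2) + i.1 % 2 + 1 := by
  unfold labelOf at h
  split_ifs at h <;> simp only [BLabel.decision.injEq] at h <;> subst h <;> simp <;> omega

variable [Fintype S]

noncomputable def nodeEquiv :
    Fin (3 * M.steps + 1) × (S × Bool) ≃ Fin ((3 * M.steps + 1) * Fintype.card (S × Bool)) :=
  (Equiv.prodCongr (Equiv.refl _) (Fintype.equivFin _)).trans finProdFinEquiv

theorem nodeEquiv_lt {u v : Fin (3 * M.steps + 1) × (S × Bool)} (h : u.1 < v.1) :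
    M.nodeEquiv u < M.nodeEquiv v := by
  rw [Fin.lt_def]
  simp only [nodeEquiv, Equiv.trans_apply, finProdFinEquiv, Equiv.prodCongr_apply, Prod.map,
    Equiv.coe_fn_mk, Equiv.refl_apply]
  have h1 := (Fintype.equivFin (S × Bool) u.2).2
  have h2 : (u.1 : ℕ) + 1 ≤ v.1 := h
  have h3 := Nat.mul_le_mul_left (Fintype.card (S × Bool)) h2
  rw [Nat.mul_add, Nat.mul_one] at h3
  omega

/-- The diagram simulating a machine. -/
noncomputable def toNBDD : NBDD n where
  size := (3 * M.steps + 1) * Fintype.card (S × Bool)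
  label u := M.labelOf (M.nodeEquiv.symm u)
  succ0 u := M.nodeEquiv (M.succOf false (M.nodeEquiv.symm u))
  succ1 u := M.nodeEquiv (M.succOf true (M.nodeEquiv.symm u))
  orSucc u := (M.choices ((M.nodeEquiv.symm u).1.1 / 3) (M.nodeEquiv.symm u).2.1).image
    fun s => M.nodeEquiv (M.nextLayer (M.nodeEquiv.symm u).1, (s, false))
  source := M.nodeEquiv (0, (M.start, false))
  succ0_lt u i h := by
    conv_lhs => rw [← M.nodeEquiv.apply_symm_apply u]
    exact M.nodeEquiv_lt (M.lt_nextLayer_of_labelOf (by simp [h]))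
  succ1_lt u i h := by
    conv_lhs => rw [← M.nodeEquiv.apply_symm_apply u]
    exact M.nodeEquiv_lt (M.lt_nextLayer_of_labelOf (by simp [h]))
  orSucc_lt u v h hv := by
    obtain ⟨s, -, rfl⟩ := Finset.mem_image.1 hv
    conv_lhs => rw [← M.nodeEquiv.apply_symm_apply u]
    exact M.nodeEquiv_lt (M.lt_nextLayer_of_labelOf (by simp [h]))

/-- The node of the simulating diagram in layer `k` with state `s` and buffered bit `c`. -/
noncomputable def node (k : ℕ) (s : S) (c : Bool) : Fin M.toNBDD.size :=
  M.nodeEquiv (⟨min k (3 * M.steps), by omega⟩, (s, c))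

theorem label_node_sink (s : S) (c : Bool) :
    M.toNBDD.label (M.node (3 * M.steps) s c) = .sink (M.acc s) := by
  simp [toNBDD, node, labelOf]

theorem label_node_or {q : ℕ} (hq : q < M.steps) (s : S) (c : Bool) :
    M.toNBDD.label (M.node (3 * q) s c) = .orNode := by
  have : min (3 * q) (3 * M.steps) = 3 * q := by omega
  have h2 : 3 * q % 3 = 0 := by omega
  simp [toNBDD, node, labelOf, this, hq]

theorem label_node_fst {q : ℕ} (hq : q < M.steps) (s : S) (c : Bool) :
    M.toNBDD.label (M.node (3 * q + 1) s c) =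
      .decision ⟨2 * q, by have := M.two_mul_steps_le; omega⟩ := by
  have h1 : min (3 * q + 1) (3 * M.steps) = 3 * q + 1 := by omega
  have h2 : (3 * q + 1) % 3 = 1 := by omega
  have h3 : (3 * q + 1) / 3 = q := by omega
  have h4 : 3 * q + 1 < 3 * M.steps := by omega
  simp [toNBDD, node, labelOf, h1, h2, h3, h4]

theorem label_node_snd {q : ℕ} (hq : q < M.steps) (s : S) (c : Bool) :
    M.toNBDD.label (M.node (3 * q + 2) s c) =
      .decision ⟨2 * q + 1, by have := M.two_mul_steps_le; omega⟩ := by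
  have h1 : min (3 * q + 2) (3 * M.steps) = 3 * q + 2 := by omega
  have h2 : (3 * q + 2) % 3 = 2 := by omega
  have h3 : (3 * q + 2) / 3 = q := by omega
  have h4 : 3 * q + 2 < 3 * M.steps := by omega
  simp [toNBDD, node, labelOf, h1, h2, h3, h4]

theorem active_node_or {b : Fin n → Bool} {q : ℕ} (hq : q < M.steps) {s : S} {c : Bool}
    {v : Fin M.toNBDD.size} :
    M.toNBDD.Active b (M.node (3 * q) s c) v ↔
      ∃ s' ∈ M.choices q s, M.node (3 * q + 1) s' false = v := by
  rw [NBDD.active_or_iff _ (M.label_node_or hq s c)]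
  have h1 : min (3 * q) (3 * M.steps) = 3 * q := by omega
  simp only [toNBDD, node, nextLayer, Equiv.symm_apply_apply, h1]
  rw [show 3 * q / 3 = q by omega]
  exact Finset.mem_image

theorem active_node_fst {b : Fin n → Bool} {q : ℕ} (hq : q < M.steps) {s : S} {c : Bool}
    {v : Fin M.toNBDD.size} :
    M.toNBDD.Active b (M.node (3 * q + 1) s c) v ↔
      v = M.node (3 * q + 2) s (bit b (2 * q)) := by
  have hn : 2 * q < n := by have := M.two_mul_steps_le; omega
  rw [NBDD.active_decision_iff _ (M.label_node_fst hq s c)]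
  have h1 : min (3 * q + 1) (3 * M.steps) = 3 * q + 1 := by omega
  have h2 : (3 * q + 1) % 3 = 1 := by omega
  have hb : bit b (2 * q) = b ⟨2 * q, hn⟩ := by simp [bit, hn]
  rw [hb]
  cases b ⟨2 * q, hn⟩ <;>
    simp [toNBDD, node, nextLayer, succOf, h1, h2]

theorem active_node_snd {b : Fin n → Bool} {q : ℕ} (hq : q < M.steps) {s : S} {c : Bool}
    {v : Fin M.toNBDD.size} :
    M.toNBDD.Active b (M.node (3 * q + 2) s c) v ↔
      v = M.node (3 * (q + 1)) (M.step q s c (bit b (2 * q + 1))) false := by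
  have hn : 2 * q + 1 < n := by have := M.two_mul_steps_le; omega
  rw [NBDD.active_decision_iff _ (M.label_node_snd hq s c)]
  have h1 : min (3 * q + 2) (3 * M.steps) = 3 * q + 2 := by omega
  have h2 : (3 * q + 2) % 3 = 2 := by omega
  have h3 : (3 * q + 2) / 3 = q := by omega
  have hb : bit b (2 * q + 1) = b ⟨2 * q + 1, hn⟩ := by simp [bit, hn]
  rw [hb]
  cases b ⟨2 * q + 1, hn⟩ <;>
    simp [toNBDD, node, nextLayer, succOf, h1, h2, h3, mul_add]

theorem acceptsFrom_node_snd {b : Fin n → Bool} {q : ℕ} (hq : q < M.steps) {s : S} {c : Bool} :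
    M.toNBDD.AcceptsFrom b (M.node (3 * q + 2) s c) ↔
      M.toNBDD.AcceptsFrom b (M.node (3 * (q + 1)) (M.step q s c (bit b (2 * q + 1))) false) := by
  rw [NBDD.acceptsFrom_iff, M.label_node_snd hq]
  simp [M.active_node_snd hq]

theorem acceptsFrom_node_fst {b : Fin n → Bool} {q : ℕ} (hq : q < M.steps) {s : S} {c : Bool} :
    M.toNBDD.AcceptsFrom b (M.node (3 * q + 1) s c) ↔
      M.toNBDD.AcceptsFrom b (M.node (3 * (q + 1))
        (M.step q s (bit b (2 * q)) (bit b (2 * q + 1))) false) := by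
  rw [NBDD.acceptsFrom_iff, M.label_node_fst hq]
  simp [M.active_node_fst hq, M.acceptsFrom_node_snd hq]

theorem acceptsFrom_node {b : Fin n → Bool} {r q : ℕ} (h : q + r = M.steps) {s : S} {c : Bool} :
    M.toNBDD.AcceptsFrom b (M.node (3 * q) s c) ↔ M.AcceptsIn b r q s := by
  induction r generalizing q s c with
  | zero =>
    obtain rfl : q = M.steps := h
    rw [NBDD.acceptsFrom_iff, M.label_node_sink]
    have := fun v => NBDD.not_active_of_sink (b := b) (v := v) _ (M.label_node_sink s c)
    simp [AcceptsIn, this]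
  | succ r ih =>
    have hq : q < M.steps := by omega
    rw [NBDD.acceptsFrom_iff, M.label_node_or hq]
    simp [M.active_node_or hq, AcceptsIn, M.acceptsFrom_node_fst hq,
      ih (show q + 1 + r = M.steps by omega)]

theorem accepts_toNBDD {b : Fin n → Bool} :
    M.toNBDD.Accepts b ↔ M.AcceptsIn b M.steps 0 M.start := by
  rw [← M.acceptsFrom_node (b := b) (c := false) (zero_add _)]
  have : M.toNBDD.source = M.node (3 * 0) M.start false := by simp [toNBDD, node]
  rw [← this]
  rfl

theorem exists_eq_node (u : Fin M.toNBDD.size) :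
    ∃ k ≤ 3 * M.steps, ∃ s c, u = M.node k s c := by
  refine ⟨(M.nodeEquiv.symm u).1.1, by omega, (M.nodeEquiv.symm u).2.1,
    (M.nodeEquiv.symm u).2.2, ?_⟩
  have : min (M.nodeEquiv.symm u).1.1 (3 * M.steps) = (M.nodeEquiv.symm u).1.1 := by omega
  simp only [node, this]
  exact (M.nodeEquiv.apply_symm_apply u).symm

theorem unambiguous_toNBDD
    (h : ∀ b q r s, q + r + 1 = M.steps → ∀ s₁ ∈ M.choices q s, ∀ s₂ ∈ M.choices q s,
      M.AcceptsIn b r (q + 1) (M.step q s₁ (bit b (2 * q)) (bit b (2 * q + 1))) →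
      M.AcceptsIn b r (q + 1) (M.step q s₂ (bit b (2 * q)) (bit b (2 * q + 1))) → s₁ = s₂) :
    M.toNBDD.Unambiguous := by
  apply NBDD.unambiguous_of_unique_succ
  intro b u v v' hv hv' ha ha'
  obtain ⟨k, hk, s, c, rfl⟩ := M.exists_eq_node u
  obtain hk | rfl := hk.lt_or_eq
  · obtain ⟨q, hq, rfl | rfl | rfl⟩ :
        ∃ q < M.steps, k = 3 * q ∨ k = 3 * q + 1 ∨ k = 3 * q + 2 :=
      ⟨k / 3, by omega, by omega⟩
    · obtain ⟨s₁, h₁, rfl⟩ := (M.active_node_or hq).1 hv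
      obtain ⟨s₂, h₂, rfl⟩ := (M.active_node_or hq).1 hv'
      obtain ⟨r, hr⟩ : ∃ r, q + r + 1 = M.steps := ⟨M.steps - q - 1, by omega⟩
      rw [M.acceptsFrom_node_fst hq, M.acceptsFrom_node (r := r) (by omega)] at ha ha'
      rw [h b q r s hr s₁ h₁ s₂ h₂ ha ha']
    · rw [M.active_node_fst hq] at hv hv'
      rw [hv, hv']
    · rw [M.active_node_snd hq] at hv hv'
      rw [hv, hv']
  · exact absurd hv (NBDD.not_active_of_sink _ (M.label_node_sink s c))

theorem layer_lt_of_edge {u v : Fin M.toNBDD.size} (h : M.toNBDD.Edge u v) :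
    (M.nodeEquiv.symm u).1 < (M.nodeEquiv.symm v).1 := by
  rcases h with ⟨i, hi, rfl | rfl⟩ | ⟨ho, hv⟩
  · simpa [toNBDD, succOf] using M.lt_nextLayer_of_labelOf
      (v := M.nodeEquiv.symm u) (fun c hc => by simp [toNBDD, hc] at hi)
  · simpa [toNBDD, succOf] using M.lt_nextLayer_of_labelOf
      (v := M.nodeEquiv.symm u) (fun c hc => by simp [toNBDD, hc] at hi)
  · obtain ⟨s, -, rfl⟩ := Finset.mem_image.1 hv
    simpa [toNBDD, succOf] using M.lt_nextLayer_of_labelOf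
      (v := M.nodeEquiv.symm u) (fun c hc => by simp [toNBDD, hc] at ho)

theorem isOBDD_toNBDD : M.toNBDD.IsOBDD 1 := by
  intro u v i j huv hi hj
  have hlt : (M.nodeEquiv.symm u).1 < (M.nodeEquiv.symm v).1 := by
    clear hi hj
    induction huv with
    | single h => exact M.layer_lt_of_edge h
    | tail _ h ih => exact ih.trans (M.layer_lt_of_edge h)
  have h1 := M.layer_of_labelOf hi
  have h2 := M.layer_of_labelOf hj
  rw [Fin.lt_def, h1, h2] at hlt
  change i.1 < j.1
  omega

end Machine

section BlockPointer

variable {n : ℕ}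

/-- The number, modulo `n + 1`, of positions `u ∈ [q, q + k)` whose control bit `2 * u` and data
bit `2 * u + 1` are both set. -/
def blockWeight (b : Fin n → Bool) : ℕ → ℕ → ZMod (n + 1)
  | _, 0 => 0
  | q, k + 1 =>
    (if bit b (2 * q) then ((bit b (2 * q + 1)).toNat : ZMod (n + 1)) else 0) +
      blockWeight b (q + 1) k

/-- Whether some position `u ∈ [q, q + k)` with unset control bit has data bit `x` and rank `e`
with `2 * e + x = W`, where ranks count the positions with unset control bit and start at `d`. -/
def pointerHits (b : Fin n → Bool) (W : ZMod (n + 1)) : ZMod (n + 1) → ℕ → ℕ → Bool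
  | _, _, 0 => false
  | d, q, k + 1 =>
    if bit b (2 * q) then pointerHits b W d (q + 1) k
    else decide (2 * d + ((bit b (2 * q + 1)).toNat : ZMod (n + 1)) = W) ||
      pointerHits b W (d + 1) (q + 1) k

/-- The value of the `i`-th block of length `B`: its weight points to a literal on a data bit. -/
def blockValue (b : Fin n → Bool) (B i : ℕ) : Bool :=
  pointerHits b (blockWeight b (i * B) B) 0 (i * B) B

/-- The conjunction of the values of the `J` blocks starting with block `i`. -/
def blocksValue (b : Fin n → Bool) (B : ℕ) : ℕ → ℕ → Bool
  | _, 0 => true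
  | i, J + 1 => blockValue b B i && blocksValue b B (i + 1) J

/-- The memory of the machine evaluating a conjunction of blocks. -/
structure BlockState (n : ℕ) where
  alive : Bool
  flag : Bool
  hit : Bool
  guess : ZMod (n + 1)
  weight : ZMod (n + 1)
  rank : ZMod (n + 1)
  deriving DecidableEq

def BlockState.equivProd (n : ℕ) : BlockState n ≃
    Bool × Bool × Bool × ZMod (n + 1) × ZMod (n + 1) × ZMod (n + 1) where
  toFun s := (s.alive, s.flag, s.hit, s.guess, s.weight, s.rank)
  invFun t := ⟨t.1, t.2.1, t.2.2.1, t.2.2.2.1, t.2.2.2.2.1, t.2.2.2.2.2⟩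
  left_inv _ := rfl
  right_inv _ := rfl

instance : Fintype (BlockState n) := Fintype.ofEquiv _ (BlockState.equivProd n).symm

theorem BlockState.card : Fintype.card (BlockState n) = 8 * (n + 1) ^ 3 := by
  rw [Fintype.card_congr (BlockState.equivProd n)]
  simp only [Fintype.card_prod, Fintype.card_bool, ZMod.card]
  ring

/-- Processing the control bit `c` and the data bit `x` of one position. -/
def BlockState.update (s : BlockState n) (c x : Bool) : BlockState n :=
  if c then { s with weight := s.weight + (x.toNat : ZMod (n + 1)) }
  else { s with
    hit := s.hit || decide (2 * s.rank + (x.toNat : ZMod (n + 1)) = s.guess)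
    rank := s.rank + 1 }

/-- Verifying the guessed weight at the end of a block. -/
def BlockState.finish (s : BlockState n) : BlockState n :=
  { s with alive := s.alive && decide (s.guess = s.weight), flag := s.flag && s.hit }

/-- The machine that guesses the weight of each of the `m` blocks of length `B` at its beginning,
verifies it at its end, and accepts when the conjunction of the block values is `τ`. -/
def blockMachine (m B : ℕ) (h : 2 * (m * B) ≤ n) (τ : Bool) : Machine n (BlockState n) where
  steps := m * B
  two_mul_steps_le := h
  choices q s :=
    if q % B = 0 then Finset.univ.image fun W => ⟨s.alive, s.flag, false, W, 0, 0⟩ else {s}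
  step q s c x := if (q + 1) % B = 0 then (s.update c x).finish else s.update c x
  start := ⟨true, true, false, 0, 0, 0⟩
  acc s := s.alive && (s.flag == τ)

variable {b : Fin n → Bool} {m B : ℕ} {h : 2 * (m * B) ≤ n} {τ : Bool}

theorem blockMachine_acceptsIn_inner {J i : ℕ}
    (H : ∀ s, (blockMachine m B h τ).AcceptsIn b (J * B) ((i + 1) * B) s ↔
      s.alive = true ∧ (s.flag && blocksValue b B (i + 1) J) = τ) (k p : ℕ) (s : BlockState n)
    (hk : p + (k + 1) = B) :
    (blockMachine m B h τ).AcceptsIn b (J * B + k) (i * B + p + 1)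
        ((blockMachine m B h τ).step (i * B + p) s
          (bit b (2 * (i * B + p))) (bit b (2 * (i * B + p) + 1))) ↔
      s.alive = true ∧ s.guess = s.weight + blockWeight b (i * B + p) (k + 1) ∧
        (s.flag && (s.hit || pointerHits b s.guess s.rank (i * B + p) (k + 1)) &&
          blocksValue b B (i + 1) J) = τ := by
  induction k generalizing p s with
  | zero =>
    have h1 : i * B + p + 1 = (i + 1) * B := by rw [add_mul]; omega
    rw [add_zero, h1, H]
    have h2 : (i + 1) * B % B = 0 := Nat.mul_mod_left _ _
    simp only [blockMachine, h1, h2, if_true, BlockState.finish, BlockState.update, blockWeight,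
      pointerHits]
    cases bit b (2 * (i * B + p)) <;> simp [and_assoc]
  | succ k ih =>
    have h2 : (i * B + p + 1) % B ≠ 0 := by
      rw [add_assoc, mul_comm, Nat.mul_add_mod, Nat.mod_eq_of_lt (by omega)]
      omega
    have h3 := fun s => ih (p + 1) s (by omega)
    simp only [← add_assoc] at h3
    have h4 : (blockMachine m B h τ).choices (i * B + p + 1) = fun s => {s} := by
      simp [blockMachine, h2]
    rw [show J * B + (k + 1) = (J * B + k) + 1 by ring, Machine.AcceptsIn]
    simp only [h4, Finset.mem_singleton, exists_eq_left, h3]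
    simp only [blockMachine, h2, if_false, BlockState.update, blockWeight, pointerHits]
    cases bit b (2 * (i * B + p)) <;> simp [add_assoc, Bool.or_assoc]

theorem blockMachine_acceptsIn (hB : 0 < B) (J i : ℕ) (s : BlockState n) :
    (blockMachine m B h τ).AcceptsIn b (J * B) (i * B) s ↔
      s.alive = true ∧ (s.flag && blocksValue b B i J) = τ := by
  induction J generalizing i s with
  | zero => simp [Machine.AcceptsIn, blockMachine, blocksValue]
  | succ J ih =>
    obtain ⟨k, rfl⟩ : ∃ k, B = k + 1 := ⟨B - 1, by omega⟩
    rw [show (J + 1) * (k + 1) = J * (k + 1) + k + 1 by ring, Machine.AcceptsIn]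
    have h3 := fun s => blockMachine_acceptsIn_inner (ih (i + 1)) k 0 s (by omega)
    simp only [add_zero] at h3
    simp only [h3]
    have h4 : (blockMachine m (k + 1) h τ).choices (i * (k + 1)) =
        fun s => Finset.univ.image fun W => ⟨s.alive, s.flag, false, W, 0, 0⟩ := by
      simp [blockMachine]
    simp only [h4, Finset.mem_image, Finset.mem_univ, true_and, blocksValue, blockValue]
    constructor
    · rintro ⟨_, ⟨W, rfl⟩, h1, h2, h5⟩
      simp only [zero_add] at h2
      refine ⟨h1, ?_⟩
      simpa [h2, Bool.and_assoc] using h5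
    · rintro ⟨h1, h2⟩
      refine ⟨_, ⟨blockWeight b (i * (k + 1)) (k + 1), rfl⟩, h1, by simp, ?_⟩
      simpa [Bool.and_assoc] using h2

theorem blockMachine_unambiguous : (blockMachine m B h τ).toNBDD.Unambiguous := by
  apply Machine.unambiguous_toNBDD
  intro b q r s hq s₁ h₁ s₂ h₂ ha₁ ha₂
  by_cases hqB : q % B = 0
  · have hq' : q + r + 1 = m * B := hq
    have hB : 0 < B := Nat.pos_of_ne_zero fun h0 => by simp [h0] at hq'
    obtain ⟨i, rfl⟩ : ∃ i, q = i * B :=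
      ⟨q / B, (Nat.div_mul_cancel (Nat.dvd_of_mod_eq_zero hqB)).symm⟩
    have hi : i < m := by
      by_contra hi
      have := Nat.mul_le_mul_right B (not_lt.1 hi)
      omega
    obtain ⟨J, rfl⟩ : ∃ J, m = i + 1 + J := ⟨m - i - 1, by omega⟩
    obtain ⟨k, rfl⟩ : ∃ k, B = k + 1 := ⟨B - 1, by omega⟩
    have hr : r = J * (k + 1) + k := by
      have : (i + 1 + J) * (k + 1) = i * (k + 1) + (J * (k + 1) + k) + 1 := by ring
      omega
    subst hr
    have h3 := fun s => blockMachine_acceptsIn_inner (b := b) (h := h) (τ := τ)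
      (blockMachine_acceptsIn hB J (i + 1)) k 0 s (by omega)
    simp only [add_zero] at h3
    rw [h3] at ha₁ ha₂
    simp only [blockMachine, hqB, if_true, Finset.mem_image, Finset.mem_univ, true_and] at h₁ h₂
    obtain ⟨W₁, rfl⟩ := h₁
    obtain ⟨W₂, rfl⟩ := h₂
    obtain rfl : W₁ = W₂ := ha₁.2.1.trans ha₂.2.1.symm
    rfl
  · simp only [blockMachine, hqB, if_false, Finset.mem_singleton] at h₁ h₂
    rw [h₁, h₂]

theorem blockMachine_accepts (hB : 0 < B) :
    (blockMachine m B h τ).toNBDD.Accepts b ↔ blocksValue b B 0 m = τ := by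
  rw [Machine.accepts_toNBDD]
  have := blockMachine_acceptsIn (b := b) (h := h) (τ := τ) hB m 0 (blockMachine m B h τ).start
  rw [zero_mul] at this
  refine this.trans ?_
  simp [blockMachine]

theorem blockMachine_size_le : (blockMachine m B h τ).toNBDD.size ≤ (n + 2) ^ 9 := by
  change (3 * (m * B) + 1) * Fintype.card (BlockState n × Bool) ≤ _
  rw [Fintype.card_prod, Fintype.card_bool, BlockState.card]
  calc (3 * (m * B) + 1) * (8 * (n + 1) ^ 3 * 2)
      ≤ (n + 2) ^ 2 * ((n + 2) ^ 3 * (n + 2) ^ 3 * (n + 2)) := by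
        gcongr
        · nlinarith
        · calc 8 = 2 ^ 3 := by norm_num
            _ ≤ (n + 2) ^ 3 := by gcongr; omega
        · omega
        · omega
    _ = (n + 2) ^ 9 := by ring

end BlockPointer

namespace NBDD

variable {n : ℕ} (G : NBDD n) (π : Equiv.Perm (Fin n))

theorem acceptsFrom_congr {b b' : Fin n → Bool} {v : Fin G.size}
    (h : ∀ w i, Relation.ReflTransGen G.Edge v w → G.label w = .decision i → b i = b' i)
    (ha : G.AcceptsFrom b v) : G.AcceptsFrom b' v := by
  obtain ⟨w, hw, hl⟩ := G.acceptsFrom_iff_reflTransGen.1 ha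
  clear ha
  induction hw using Relation.ReflTransGen.head_induction_on with
  | refl => exact G.acceptsFrom_iff.2 (.inl hl)
  | @head x y hxy _ ih =>
    refine G.acceptsFrom_iff.2 (.inr ⟨y, ?_, ih fun w i hyw => h w i (.head hxy.edge hyw)⟩)
    rcases hxy with ⟨i, hi, rfl⟩ | hxy
    · exact .inl ⟨i, hi, by rw [h x i .refl hi]⟩
    · exact .inr hxy

/-- One deterministic step of the computation, stopping at decision nodes whose variable has
position at least `t`. -/
def advance (t : ℕ) (b : Fin n → Bool) (v : Fin G.size) : Fin G.size :=
  match G.label v with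
  | .decision i =>
    if (π.symm i : ℕ) < t then (if b i then G.succ1 v else G.succ0 v) else v
  | _ => v

/-- The node at which the deterministic computation starting in `u` has read exactly the
variables with position below `t`. -/
def stateAt (t : ℕ) (b : Fin n → Bool) (u : Fin G.size) : Fin G.size :=
  (G.advance π t b)^[G.size] u

variable {G π}

theorem stateAt_congr {t : ℕ} {b b' : Fin n → Bool}
    (h : ∀ i, (π.symm i : ℕ) < t → b i = b' i) : G.stateAt π t b = G.stateAt π t b' := by
  have : G.advance π t b = G.advance π t b' := by
    funext v
    unfold advance
    split
    · split_ifs with h1 <;> simp_all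
    · rfl
  funext u
  simp only [stateAt, this]

theorem advance_eq_or_active (t : ℕ) (b : Fin n → Bool) (v : Fin G.size) :
    G.advance π t b v = v ∨
      (∃ i, G.label v = .decision i) ∧ G.Active b v (G.advance π t b v) := by
  unfold advance
  split
  · rename_i i hi
    split_ifs
    · exact .inr ⟨⟨i, hi⟩, .inl ⟨i, hi, by simp_all⟩⟩
    · exact .inr ⟨⟨i, hi⟩, .inl ⟨i, hi, by simp_all⟩⟩
    · exact .inl rfl
  · exact .inl rfl

theorem lt_of_active {b : Fin n → Bool} {u v : Fin G.size} (h : G.Active b u v) : u < v := by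
  rcases h with ⟨i, hi, rfl⟩ | ⟨ho, hv⟩
  · split_ifs
    exacts [G.succ1_lt u i hi, G.succ0_lt u i hi]
  · exact G.orSucc_lt u v ho hv

theorem acceptsFrom_advance {t : ℕ} {b : Fin n → Bool} {v : Fin G.size} :
    G.AcceptsFrom b (G.advance π t b v) ↔ G.AcceptsFrom b v := by
  rcases advance_eq_or_active (G := G) (π := π) t b v with h | ⟨⟨i, hi⟩, ha⟩
  · rw [h]
  · rw [G.acceptsFrom_iff (s := v)]
    have h1 := (G.active_decision_iff hi).1 ha
    simp [hi, G.active_decision_iff hi, h1]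

theorem acceptsFrom_stateAt {t : ℕ} {b : Fin n → Bool} {v : Fin G.size} :
    G.AcceptsFrom b (G.stateAt π t b v) ↔ G.AcceptsFrom b v := by
  have key : ∀ k, G.AcceptsFrom b ((G.advance π t b)^[k] v) ↔ G.AcceptsFrom b v := by
    intro k
    induction k with
    | zero => rfl
    | succ k ih => rw [Function.iterate_succ_apply', acceptsFrom_advance, ih]
  exact key G.size

theorem advance_stateAt (t : ℕ) (b : Fin n → Bool) (v : Fin G.size) :
    G.advance π t b (G.stateAt π t b v) = G.stateAt π t b v := by
  have key : ∀ k, G.advance π t b ((G.advance π t b)^[k] v) = (G.advance π t b)^[k] v ∨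
      k ≤ ((G.advance π t b)^[k] v : ℕ) := by
    intro k
    induction k with
    | zero => exact .inr (Nat.zero_le _)
    | succ k ih =>
      rw [Function.iterate_succ_apply']
      rcases ih with ih | ih
      · left; rw [ih, ih]
      · rcases advance_eq_or_active (G := G) (π := π) t b ((G.advance π t b)^[k] v) with h | ⟨-, h⟩
        · left; rw [h, h]
        · right
          have := Fin.lt_def.1 (lt_of_active h)
          omega
  exact (key G.size).resolve_right (by omega)

theorem label_stateAt_ne_orNode (ho : G.OrNodesFirst) {t : ℕ} {b : Fin n → Bool}
    {v : Fin G.size} (hv : G.label v ≠ .orNode) : G.label (G.stateAt π t b v) ≠ .orNode := by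
  have key : ∀ k, G.label ((G.advance π t b)^[k] v) ≠ .orNode := by
    intro k
    induction k with
    | zero => exact hv
    | succ k ih =>
      rw [Function.iterate_succ_apply']
      rcases advance_eq_or_active (G := G) (π := π) t b ((G.advance π t b)^[k] v) with h | ⟨-, h⟩
      · rwa [h]
      · exact fun h' => ih (ho _ _ h.edge h')
  exact key G.size

theorem le_of_reachable_of_advance_eq (hπ : G.IsOBDD π) {t : ℕ} {b : Fin n → Bool}
    {v w : Fin G.size} {i : Fin n} (hv : G.label v ≠ .orNode) (hfix : G.advance π t b v = v)
    (hw : Relation.ReflTransGen G.Edge v w) (hi : G.label w = .decision i) :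
    t ≤ (π.symm i : ℕ) := by
  have hroot : ∀ j, G.label v = .decision j → t ≤ (π.symm j : ℕ) := by
    intro j hj
    by_contra! hlt
    have hact : G.Active b v (G.advance π t b v) :=
      .inl ⟨j, hj, by simp [advance, hj, hlt]⟩
    rw [hfix] at hact
    exact (lt_of_active hact).false
  rcases Relation.reflTransGen_iff_eq_or_transGen.1 hw with rfl | htr
  · exact hroot i hi
  · obtain ⟨c, hc, -⟩ := Relation.TransGen.head'_iff.1 htr
    rcases hc with ⟨j, hj, -⟩ | ⟨ho, -⟩
    · exact (hroot j hj).trans (Fin.lt_def.1 (hπ v w j i htr hj hi)).le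
    · exact absurd ho hv

/-- In the deterministic part of an ordered diagram, prefixes leading to the same node are
interchangeable. -/
theorem acceptsFrom_of_stateAt_eq (hπ : G.IsOBDD π) (ho : G.OrNodesFirst) {u : Fin G.size}
    (hu : G.label u ≠ .orNode) {t : ℕ} {b b' : Fin n → Bool}
    (hs : G.stateAt π t b' u = G.stateAt π t b u) (ha : G.AcceptsFrom b u) :
    G.AcceptsFrom (fun i => if (π.symm i : ℕ) < t then b' i else b i) u := by
  rw [← acceptsFrom_stateAt (π := π) (t := t)] at ha ⊢
  rw [stateAt_congr (b' := b') (fun i hi => by simp [hi]), hs]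
  refine G.acceptsFrom_congr (fun w i hw hi => ?_) ha
  have := le_of_reachable_of_advance_eq hπ (label_stateAt_ne_orNode ho hu)
    (advance_stateAt t b u) hw hi
  simp [not_lt.2 this]

/-- Every accepted input is accepted from a node below which the diagram is deterministic. -/
theorem exists_deterministic_root {f : (Fin n → Bool) → Bool} (hf : G.Represents f)
    {b : Fin n → Bool} (hb : f b = true) :
    ∃ u, G.label u ≠ .orNode ∧ (∀ b', G.AcceptsFrom b' u → f b' = true) ∧
      G.AcceptsFrom b u := by
  have hsrc : ∀ b', G.AcceptsFrom b' G.source → f b' = true := fun b' h => (hf b').2 h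
  obtain ⟨w, hw, hl⟩ := G.acceptsFrom_iff_reflTransGen.1 ((hf b).1 hb)
  generalize G.source = s at hsrc hw
  induction hw using Relation.ReflTransGen.head_induction_on with
  | refl => exact ⟨w, by simp [hl], hsrc, G.acceptsFrom_iff.2 (.inl hl)⟩
  | @head x y hxy hyw ih =>
    by_cases hx : G.label x = .orNode
    · refine ih fun b' h => hsrc b' (G.acceptsFrom_iff.2 (.inr ⟨y, ?_, h⟩))
      rw [G.active_or_iff hx] at hxy ⊢
      exact hxy
    · exact ⟨x, hx, hsrc, G.acceptsFrom_iff_reflTransGen.2 ⟨w, .head hxy hyw, hl⟩⟩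

end NBDD

section Counting

open Finset

/-- The coordinates on which all members of `A` agree. -/
def agreeSet {a : ℕ} (A : Finset (Fin a → Bool)) : Finset (Fin a) :=
  univ.filter fun k => ∀ x ∈ A, ∀ y ∈ A, x k = y k

theorem card_le_two_pow_agreeSet {a : ℕ} (A : Finset (Fin a → Bool)) :
    #A ≤ 2 ^ (a - #(agreeSet A)) := by
  calc #A ≤ #(univ : Finset ({k // k ∉ agreeSet A} → Bool)) := by
        refine card_le_card_of_injOn (fun x k => x k) (by simp) fun x hx y hy hxy => ?_
        funext k
        by_cases hk : k ∈ agreeSet A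
        · exact (mem_filter.1 hk).2 x hx y hy
        · exact congrFun hxy ⟨k, hk⟩
    _ = 2 ^ (a - #(agreeSet A)) := by
        rw [card_univ, Fintype.card_fun, Fintype.card_bool, Fintype.card_subtype_compl]
        simp

theorem card_agreeSet_le {h : ℕ} {A : Finset (Fin (2 * h) → Bool)} (hA : 2 ^ h < #A) :
    #(agreeSet A) ≤ h := by
  by_contra! hlt
  have := (card_le_two_pow_agreeSet A).trans
    (Nat.pow_le_pow_right two_pos (show 2 * h - #(agreeSet A) ≤ h by omega))
  omega

theorem card_filter_lt_lt {a : ℕ} {K : Finset (Fin a)} {k : Fin a} (hk : k ∈ K) :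
    #(K.filter (· < k)) < #K :=
  card_lt_card (filter_ssubset.2 ⟨k, hk, lt_irrefl k⟩)

theorem card_filter_lt_injOn {a : ℕ} (K : Finset (Fin a)) :
    Set.InjOn (fun k => #(K.filter (· < k))) K := by
  have key : ∀ k ∈ K, ∀ k', k < k' → #(K.filter (· < k)) < #(K.filter (· < k')) := by
    intro k hk k' hlt
    refine card_lt_card (ssubset_iff_of_subset ?_ |>.2 ⟨k, by simp [hk, hlt], by simp⟩)
    exact fun x hx => by
      rw [mem_filter] at hx ⊢
      exact ⟨hx.1, hx.2.trans hlt⟩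
  intro k hk k' hk' heq
  rcases lt_trichotomy k k' with hlt | rfl | hlt
  · exact absurd heq (key k hk k' hlt).ne
  · rfl
  · exact absurd heq (key k' hk' k hlt).ne'

/-- If the set `K p.1 p.2 i` of allowed values for `p.2 i` depends only on `p.1` and on the
coordinates of `p.2` with smaller `T`, then the number of admissible `p` is bounded as for a
product. -/
theorem card_filter_dependent_le {α : Type*} [Fintype α] {m a h : ℕ} (T : Fin m → ℕ)
    (K : α → (Fin m → Fin a) → Fin m → Finset (Fin a))
    (hK : ∀ l j j' i, (∀ i', T i' < T i → j i' = j' i') → K l j i = K l j' i)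
    (P : Finset (α × (Fin m → Fin a)))
    (hP : ∀ p ∈ P, ∀ i, p.2 i ∈ K p.1 p.2 i ∧ #(K p.1 p.2 i) ≤ h) :
    #P ≤ Fintype.card α * h ^ m := by
  calc #P ≤ #((univ : Finset α) ×ˢ Fintype.piFinset fun _ : Fin m => range h) := by
        refine card_le_card_of_injOn
          (fun p => (p.1, fun i => #((K p.1 p.2 i).filter (· < p.2 i)))) ?_ ?_
        · intro p hp
          simp only [coe_product, coe_univ, Set.mem_prod, Set.mem_univ, true_and, mem_coe,
            Fintype.mem_piFinset, mem_range]
          exact fun i => (card_filter_lt_lt (hP p hp i).1).trans_le (hP p hp i).2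
        · rintro ⟨l, j⟩ hp ⟨l', j'⟩ hp' heq
          obtain ⟨rfl, hc⟩ := Prod.mk.inj heq
          congr 1
          have key : ∀ t i, T i = t → j i = j' i := by
            intro t
            induction t using Nat.strong_induction_on with
            | _ t ih =>
              rintro i rfl
              have hKi := hK l j j' i fun i' hi' => ih _ hi' i' rfl
              have hci := congrFun hc i
              have h1 := (hP _ hp i).1
              have h2 := (hP _ hp' i).1
              simp only at hci h1 h2
              rw [hKi] at hci h1
              exact card_filter_lt_injOn _ h1 h2 hci
          exact funext fun i => key _ i rfl
    _ = Fintype.card α * h ^ m := by simp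

theorem card_filter_apply_mem_mul {β : Type*} [Fintype β] {m a : ℕ} (i : Fin m)
    (S : Finset (Fin a → Bool)) :
    #(univ.filter fun p : (Fin m → Fin a → Bool) × β => p.1 i ∈ S) * 2 ^ a ≤
      #S * Fintype.card ((Fin m → Fin a → Bool) × β) := by
  classical
  calc #(univ.filter fun p : (Fin m → Fin a → Bool) × β => p.1 i ∈ S) * 2 ^ a
      = #((univ.filter fun p : (Fin m → Fin a → Bool) × β => p.1 i ∈ S) ×ˢ
          (univ : Finset (Fin a → Bool))) := by simp
    _ ≤ #(S ×ˢ (univ : Finset ((Fin m → Fin a → Bool) × β))) := by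
        refine card_le_card_of_injOn
          (fun p => (p.1.1 i, (Function.update p.1.1 i p.2, p.1.2))) ?_ ?_
        · intro p hp
          simpa using hp
        · rintro ⟨⟨l, j⟩, x⟩ - ⟨⟨l', j'⟩, x'⟩ - heq
          simp only [Prod.mk.injEq] at heq
          obtain ⟨h1, h2, rfl⟩ := heq
          have hx : x = x' := by simpa using congrFun h2 i
          subst hx
          have hl : l = l' := by
            funext i'
            by_cases hi : i' = i
            · rw [hi, h1]
            · simpa [hi] using congrFun h2 i'
          rw [hl]
    _ = _ := by rw [card_product, card_univ]

/-- The number of pairs accepted by one deterministic diagram, which is described by the nodes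
`σ i l j` that it reaches at the cut of the `i`-th block. -/
theorem card_accepted_mul_le {V : Type*} [Fintype V] {m h : ℕ} (T : Fin m → ℕ)
    (σ : Fin m → (Fin m → Fin (2 * h) → Bool) → (Fin m → Fin (2 * h)) → V)
    (hσ : ∀ l j j' i, (∀ i', T i' < T i → j i' = j' i') → σ i l j = σ i l j')
    (P : Finset ((Fin m → Fin (2 * h) → Bool) × (Fin m → Fin (2 * h))))
    (hP : ∀ p ∈ P, ∀ i l' j', σ i l' j' = σ i p.1 p.2 → l' i (p.2 i) = p.1 i (p.2 i)) :
    #P * 2 ^ (2 * h) ≤ m * (Fintype.card V * 2 ^ h) * ((2 ^ (2 * h)) ^ m * (2 * h) ^ m) +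
      (2 ^ (2 * h)) ^ m * h ^ m * 2 ^ (2 * h) := by
  classical
  let A : Fin m → V → Finset (Fin (2 * h) → Bool) := fun i v =>
    (univ.filter fun p : (Fin m → Fin (2 * h) → Bool) × (Fin m → Fin (2 * h)) =>
      σ i p.1 p.2 = v).image fun p => p.1 i
  let S : Fin m → Finset (Fin (2 * h) → Bool) := fun i =>
    (univ.filter fun v => #(A i v) ≤ 2 ^ h).biUnion (A i)
  have hS : ∀ i, #(S i) ≤ Fintype.card V * 2 ^ h := fun i =>
    (card_biUnion_le_card_mul _ _ _ fun v hv => (mem_filter.1 hv).2).trans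
      (Nat.mul_le_mul_right _ (card_le_univ _))
  have hA : ∀ i (p : (Fin m → Fin (2 * h) → Bool) × (Fin m → Fin (2 * h))),
      p.1 i ∈ A i (σ i p.1 p.2) := fun i p => mem_image.2 ⟨p, by simp, rfl⟩
  let Q := P.filter fun p => ∀ i, 2 ^ h < #(A i (σ i p.1 p.2))
  have hQ : #Q ≤ (2 ^ (2 * h)) ^ m * h ^ m := by
    have := card_filter_dependent_le (h := h) T (fun l j i => agreeSet (A i (σ i l j)))
      (fun l j j' i hj => by simp only [hσ l j j' i hj]) Q ?_
    · simpa using this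
    · intro p hp i
      obtain ⟨hpP, hbig⟩ := mem_filter.1 hp
      refine ⟨?_, card_agreeSet_le (hbig i)⟩
      have hmem : ∀ x ∈ A i (σ i p.1 p.2), x (p.2 i) = p.1 i (p.2 i) := by
        intro x hx
        obtain ⟨q, hq, rfl⟩ := mem_image.1 hx
        exact hP p hpP i q.1 q.2 (mem_filter.1 hq).2
      exact mem_filter.2 ⟨mem_univ _, fun x hx y hy => (hmem x hx).trans (hmem y hy).symm⟩
  let R : Fin m → Finset ((Fin m → Fin (2 * h) → Bool) × (Fin m → Fin (2 * h))) := fun i =>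
    univ.filter fun p => p.1 i ∈ S i
  have hR : ∀ i, #(R i) * 2 ^ (2 * h) ≤
      (Fintype.card V * 2 ^ h) * ((2 ^ (2 * h)) ^ m * (2 * h) ^ m) := by
    intro i
    refine (card_filter_apply_mem_mul i (S i)).trans ?_
    refine (Nat.mul_le_mul_right _ (hS i)).trans (le_of_eq ?_)
    simp
  have hsub : P ⊆ univ.biUnion R ∪ Q := by
    intro p hp
    rw [mem_union]
    by_cases hbig : ∀ i, 2 ^ h < #(A i (σ i p.1 p.2))
    · exact .inr (mem_filter.2 ⟨hp, hbig⟩)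
    · push Not at hbig
      obtain ⟨i, hi⟩ := hbig
      refine .inl (mem_biUnion.2 ⟨i, mem_univ _, mem_filter.2 ⟨mem_univ _, ?_⟩⟩)
      exact mem_biUnion.2 ⟨_, mem_filter.2 ⟨mem_univ _, hi⟩, hA i p⟩
  calc #P * 2 ^ (2 * h) ≤ (∑ i, #(R i) + #Q) * 2 ^ (2 * h) := by
        gcongr
        exact (card_le_card hsub).trans ((card_union_le _ _).trans
          (Nat.add_le_add_right card_biUnion_le _))
    _ = ∑ i, #(R i) * 2 ^ (2 * h) + #Q * 2 ^ (2 * h) := by rw [add_mul, sum_mul]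
    _ ≤ ∑ _i : Fin m, (Fintype.card V * 2 ^ h) * ((2 ^ (2 * h)) ^ m * (2 * h) ^ m) +
          (2 ^ (2 * h)) ^ m * h ^ m * 2 ^ (2 * h) := by
        exact Nat.add_le_add (sum_le_sum fun i _ => hR i) (Nat.mul_le_mul_right _ hQ)
    _ = _ := by simp [mul_assoc]

end Counting

open Finset in
/-- A family of accepted inputs in which `m` blocks each hide a pointer into their first part
forces diagrams with all nondeterminism at the beginning to be large. -/
theorem NBDD.le_of_pointer_family {n m h : ℕ} {G : NBDD n} {π : Equiv.Perm (Fin n)}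
    (hπ : G.IsOBDD π) (ho : G.OrNodesFirst) {f : (Fin n → Bool) → Bool} (hf : G.Represents f)
    (T : Fin m → ℕ)
    (inp : (Fin m → Fin (2 * h) → Bool) → (Fin m → Fin (2 * h)) → Fin n → Bool)
    (hinp : ∀ l j, f (inp l j) = true)
    (hloc : ∀ l j j' i, (∀ i', T i' < T i → j i' = j' i') →
      ∀ x, (π.symm x : ℕ) < T i → inp l j x = inp l j' x)
    (hcross : ∀ l j l' j' i,
      f (fun x => if (π.symm x : ℕ) < T i then inp l' j' x else inp l j x) = true →
        l' i (j i) = l i (j i)) :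
    (2 ^ (2 * h)) ^ m * (2 * h) ^ m * 2 ^ (2 * h) ≤
      G.size * (m * (G.size * 2 ^ h) * ((2 ^ (2 * h)) ^ m * (2 * h) ^ m) +
        (2 ^ (2 * h)) ^ m * h ^ m * 2 ^ (2 * h)) := by
  classical
  let U : Finset (Fin G.size) := univ.filter fun u =>
    G.label u ≠ .orNode ∧ ∀ b', G.AcceptsFrom b' u → f b' = true
  let P : Fin G.size → Finset ((Fin m → Fin (2 * h) → Bool) × (Fin m → Fin (2 * h))) := fun u =>
    univ.filter fun p => G.AcceptsFrom (inp p.1 p.2) u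
  have hP : ∀ u ∈ U, #(P u) * 2 ^ (2 * h) ≤
      m * (G.size * 2 ^ h) * ((2 ^ (2 * h)) ^ m * (2 * h) ^ m) +
        (2 ^ (2 * h)) ^ m * h ^ m * 2 ^ (2 * h) := by
    intro u hu
    obtain ⟨-, hor, hacc⟩ := mem_filter.1 hu
    have := card_accepted_mul_le T (fun i l j => G.stateAt π (T i) (inp l j) u)
      (fun l j j' i hj => by rw [stateAt_congr (hloc l j j' i hj)]) (P u) ?_
    · simpa using this
    · intro p hp i l' j' heq
      exact hcross _ _ _ j' i (hacc _ (acceptsFrom_of_stateAt_eq hπ ho hor heq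
        (mem_filter.1 hp).2))
  have hcover : (univ : Finset ((Fin m → Fin (2 * h) → Bool) × (Fin m → Fin (2 * h)))) ⊆
      U.biUnion P := by
    intro p _
    obtain ⟨u, h1, h2, h3⟩ := exists_deterministic_root hf (hinp p.1 p.2)
    exact mem_biUnion.2 ⟨u, mem_filter.2 ⟨mem_univ _, h1, h2⟩, mem_filter.2 ⟨mem_univ _, h3⟩⟩
  calc (2 ^ (2 * h)) ^ m * (2 * h) ^ m * 2 ^ (2 * h)
      = #(univ : Finset ((Fin m → Fin (2 * h) → Bool) × (Fin m → Fin (2 * h)))) *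
          2 ^ (2 * h) := by simp
    _ ≤ (∑ u ∈ U, #(P u)) * 2 ^ (2 * h) := by
        gcongr
        exact (card_le_card hcover).trans card_biUnion_le
    _ = ∑ u ∈ U, #(P u) * 2 ^ (2 * h) := sum_mul ..
    _ ≤ #U * (m * (G.size * 2 ^ h) * ((2 ^ (2 * h)) ^ m * (2 * h) ^ m) +
        (2 ^ (2 * h)) ^ m * h ^ m * 2 ^ (2 * h)) := by
        exact (sum_le_card_nsmul _ _ _ hP).trans_eq (smul_eq_mul ..)
    _ ≤ _ := by
        gcongr
        simpa using card_le_univ U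

section PointerFamily

open Finset

theorem bit_of_lt {n : ℕ} (b : Fin n → Bool) {u : ℕ} (hu : u < n) : bit b u = b ⟨u, hu⟩ :=
  dif_pos hu

theorem exists_card_filter_lt_eq {s : Finset ℕ} {g : ℕ → ℕ} (hg : Set.InjOn g s) {a : ℕ}
    (ha : a ≤ #s) : ∃ t, #(s.filter fun p => g p < t) = a := by
  have hstep : ∀ t, #(s.filter fun p => g p < t + 1) ≤ #(s.filter fun p => g p < t) + 1 := by
    intro t
    have hsub : (s.filter fun p => g p < t + 1) ⊆
        (s.filter fun p => g p < t) ∪ s.filter fun p => g p = t := by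
      intro p hp
      simp only [mem_union, mem_filter] at hp ⊢
      rcases Nat.lt_succ_iff_lt_or_eq.1 hp.2 with h | h
      exacts [.inl ⟨hp.1, h⟩, .inr ⟨hp.1, h⟩]
    refine (card_le_card hsub).trans ((card_union_le _ _).trans (Nat.add_le_add_left ?_ _))
    refine card_le_one.2 fun p hp p' hp' => ?_
    simp only [mem_filter] at hp hp'
    exact hg hp.1 hp'.1 (hp.2.trans hp'.2.symm)
  have hex : ∃ t, a ≤ #(s.filter fun p => g p < t) := by
    refine ⟨s.sup g + 1, ha.trans_eq ?_⟩
    rw [filter_true_of_mem fun p hp => Nat.lt_succ_of_le (le_sup hp)]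
  classical
  refine ⟨Nat.find hex, le_antisymm ?_ (Nat.find_spec hex)⟩
  rcases ht : Nat.find hex with _ | t
  · simp
  · have := Nat.find_min hex (m := t) (by omega)
    have := hstep t
    omega

theorem card_filter_lt_orderEmbOfFin {s : Finset ℕ} {a : ℕ} (hs : #s = a) (k : Fin a) :
    #(s.filter fun p => p < s.orderEmbOfFin hs k) = k := by
  have : (s.filter fun p => p < s.orderEmbOfFin hs k) =
      (Iio k).map (s.orderEmbOfFin hs).toEmbedding := by
    ext p
    simp only [mem_filter, mem_map, mem_Iio]
    constructor
    · rintro ⟨hp, hlt⟩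
      obtain ⟨k', rfl⟩ : p ∈ Set.range (s.orderEmbOfFin hs) := by simpa using hp
      exact ⟨k', (s.orderEmbOfFin hs).lt_iff_lt.1 hlt, rfl⟩
    · rintro ⟨k', hk, rfl⟩
      exact ⟨s.orderEmbOfFin_mem hs k', (s.orderEmbOfFin hs).lt_iff_lt.2 hk⟩
  rw [this, card_map, Fin.card_Iio]

variable {n : ℕ} {b : Fin n → Bool}

theorem blockWeight_eq_sum (q k : ℕ) : blockWeight b q k = ∑ p ∈ range k,
    if bit b (2 * (q + p)) = true ∧ bit b (2 * (q + p) + 1) = true then 1 else 0 := by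
  induction k generalizing q with
  | zero => rfl
  | succ k ih =>
    rw [sum_range_succ', blockWeight, ih, add_comm (∑ _ ∈ _, _)]
    congr 1
    · cases bit b (2 * q) <;> cases bit b (2 * q + 1) <;> simp
    · exact sum_congr rfl fun p _ => by rw [show q + 1 + p = q + (p + 1) by ring]

theorem pointerHits_iff {W d : ZMod (n + 1)} {q k : ℕ} : pointerHits b W d q k = true ↔
    ∃ p < k, bit b (2 * (q + p)) = false ∧
      2 * (d + ∑ p' ∈ range p, if bit b (2 * (q + p')) = false then 1 else 0) +
        ((bit b (2 * (q + p) + 1)).toNat : ZMod (n + 1)) = W := by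
  induction k generalizing q d with
  | zero => simp [pointerHits]
  | succ k ih =>
    have hshift : ∀ p, q + 1 + p = q + (p + 1) := fun p => by ring
    rw [Nat.exists_lt_succ_left]
    simp only [pointerHits, sum_range_succ']
    cases bit b (2 * q)
    · have hd : ∀ S : ZMod (n + 1), d + (S + 1) = d + 1 + S := fun S => by ring
      simp [ih, hd, hshift]
    · simp [ih, hshift]

theorem blocksValue_iff {B i J : ℕ} :
    blocksValue b B i J = true ↔ ∀ i' < J, blockValue b B (i + i') = true := by
  induction J generalizing i with
  | zero => simp [blocksValue]
  | succ J ih =>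
    have hshift : ∀ i', i + 1 + i' = i + (i' + 1) := fun i' => by ring
    simp only [blocksValue, Bool.and_eq_true, ih, Nat.forall_lt_succ_left, add_zero, hshift]

/-- The value of a block whose control bits vanish exactly on `L`, whose data bits on `L` are given
by `l`, and whose remaining data bits have weight `2 * j + v`. -/
theorem blockValue_iff_of_pointer {B i a : ℕ} {L : Finset ℕ} (hLB : L ⊆ range B) (hL : #L = a)
    (ha : 2 * a ≤ n) {l : Fin a → Bool} {j : Fin a} {v : Bool}
    (hc : ∀ p < B, bit b (2 * (i * B + p)) = decide (p ∉ L))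
    (hl : ∀ k, bit b (2 * (i * B + L.orderEmbOfFin hL k) + 1) = l k)
    (hw : #((range B \ L).filter fun p => bit b (2 * (i * B + p) + 1) = true) = 2 * j + v.toNat) :
    blockValue b B i = true ↔ l j = v := by
  have hW : blockWeight b (i * B) B = ((2 * j + v.toNat : ℕ) : ZMod (n + 1)) := by
    rw [blockWeight_eq_sum, sum_boole, ← hw]
    congr 2
    ext p
    simp only [mem_filter, mem_sdiff, mem_range, and_assoc]
    refine and_congr_right fun hp => ?_
    rw [hc p hp]
    simp
  have hrank : ∀ k, (∑ p ∈ range (L.orderEmbOfFin hL k),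
      if bit b (2 * (i * B + p)) = false then 1 else 0 : ZMod (n + 1)) = (k : ℕ) := by
    intro k
    rw [sum_boole, ← card_filter_lt_orderEmbOfFin hL k]
    congr 2
    ext p
    simp only [mem_filter, mem_range]
    rw [and_comm]
    refine and_congr_left fun hp => ?_
    rw [hc p (hp.trans (mem_range.1 (hLB (L.orderEmbOfFin_mem hL k))))]
    simp
  have hcast : ∀ (k : Fin a) (x : Bool),
      (2 * (0 + ((k : ℕ) : ZMod (n + 1))) + (x.toNat : ZMod (n + 1)) =
        ((2 * j + v.toNat : ℕ) : ZMod (n + 1))) ↔ k = j ∧ x = v := by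
    intro k x
    have hx := Bool.toNat_le x
    have hv := Bool.toNat_le v
    constructor
    · intro h
      have h' : ((2 * k + x.toNat : ℕ) : ZMod (n + 1)) = ((2 * j + v.toNat : ℕ) : ZMod (n + 1)) := by
        rw [← h]; push_cast; ring
      rw [ZMod.natCast_eq_natCast_iff', Nat.mod_eq_of_lt (by omega),
        Nat.mod_eq_of_lt (by omega)] at h'
      refine ⟨Fin.ext (by omega), ?_⟩
      have : x.toNat = v.toNat := by omega
      revert this
      cases x <;> cases v <;> simp
    · rintro ⟨rfl, rfl⟩
      push_cast; ring
  rw [blockValue, hW, pointerHits_iff]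
  constructor
  · rintro ⟨p, hp, hctrl, heq⟩
    rw [hc p hp, decide_eq_false_iff_not, not_not] at hctrl
    obtain ⟨k, rfl⟩ : p ∈ Set.range (L.orderEmbOfFin hL) := by simpa using hctrl
    rw [hrank, hl, hcast] at heq
    rw [← heq.1, heq.2]
  · intro h
    have hmem := L.orderEmbOfFin_mem hL j
    refine ⟨L.orderEmbOfFin hL j, mem_range.1 (hLB hmem), ?_, ?_⟩
    · rw [hc _ (mem_range.1 (hLB hmem))]
      simp [hmem]
    · rw [hrank, hl, hcast]
      exact ⟨rfl, h⟩

/-- The input whose `i`-th block has the control bits `C i` and the data bits `D i`. -/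
def blockInput (n : ℕ) {m : ℕ} (B : ℕ) (C D : Fin m → ℕ → Bool) (x : Fin n) : Bool :=
  if h : x.1 / 2 / B < m then
    if x.1 % 2 = 0 then C ⟨_, h⟩ (x.1 / 2 % B) else D ⟨_, h⟩ (x.1 / 2 % B)
  else false

theorem blockInput_control {m B : ℕ} {C D : Fin m → ℕ → Bool} {i : Fin m} {p : ℕ} (hp : p < B)
    (hx : 2 * (i * B + p) < n) : blockInput n B C D ⟨2 * (i * B + p), hx⟩ = C i p := by
  have h1 : 2 * (i * B + p) / 2 = i * B + p := by omega
  have h2 : (i * B + p) / B = i := by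
    rw [mul_comm, Nat.mul_add_div (by omega), Nat.div_eq_of_lt hp, add_zero]
  have h3 : (i * B + p) % B = p := by
    rw [mul_comm, Nat.mul_add_mod, Nat.mod_eq_of_lt hp]
  simp [blockInput, h1, h2, h3]

theorem blockInput_data {m B : ℕ} {C D : Fin m → ℕ → Bool} {i : Fin m} {p : ℕ} (hp : p < B)
    (hx : 2 * (i * B + p) + 1 < n) : blockInput n B C D ⟨2 * (i * B + p) + 1, hx⟩ = D i p := by
  have h1 : (2 * (i * B + p) + 1) / 2 = i * B + p := by omega
  have h2 : (i * B + p) / B = i := by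
    rw [mul_comm, Nat.mul_add_div (by omega), Nat.div_eq_of_lt hp, add_zero]
  have h3 : (i * B + p) % B = p := by
    rw [mul_comm, Nat.mul_add_mod, Nat.mod_eq_of_lt hp]
  have h4 : (2 * (i * B + p) + 1) % 2 = 1 := by omega
  simp [blockInput, h1, h2, h3, h4]

theorem NBDD.le_of_represents_blocksValue {m h B : ℕ} (hmB : 2 * (m * B) ≤ n)
    (hB : 3 * (2 * h) ≤ B) {G : NBDD n} {π : Equiv.Perm (Fin n)} (hπ : G.IsOBDD π)
    (ho : G.OrNodesFirst) (hf : G.Represents fun b => blocksValue b B 0 m) :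
    (2 ^ (2 * h)) ^ m * (2 * h) ^ m * 2 ^ (2 * h) ≤
      G.size * (m * (G.size * 2 ^ h) * ((2 ^ (2 * h)) ^ m * (2 * h) ^ m) +
        (2 ^ (2 * h)) ^ m * h ^ m * 2 ^ (2 * h)) := by
  classical
  have hlt : ∀ (i : Fin m) {p : ℕ}, p < B → 2 * (i * B + p) + 1 < n := by
    intro i p hp
    have : (i + 1) * B ≤ m * B := Nat.mul_le_mul_right B i.2
    rw [add_mul] at this
    omega
  let pos : Fin m → ℕ → ℕ := fun i p =>
    if hp : p < B then π.symm ⟨2 * (i * B + p) + 1, hlt i hp⟩ else 0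
  have hposInj : ∀ i, Set.InjOn (pos i) (range B) := by
    intro i p hp p' hp' heq
    rw [mem_coe, mem_range] at hp hp'
    simp only [pos, hp, hp', dif_pos] at heq
    have := Fin.mk.inj (π.symm.injective (Fin.ext heq))
    omega
  choose T hT using fun i => exists_card_filter_lt_eq (hposInj i) (a := 2 * h)
    (by rw [card_range]; omega)
  let L : Fin m → Finset ℕ := fun i => (range B).filter fun p => pos i p < T i
  have hLB : ∀ i, L i ⊆ range B := fun i => filter_subset _ _
  have hR : ∀ i W, ∃ R ⊆ range B \ L i, W ≤ 2 * (2 * h) → #R = W := by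
    intro i W
    by_cases hW : W ≤ 2 * (2 * h)
    · obtain ⟨R, h1, h2⟩ := exists_subset_card_eq (s := range B \ L i) (n := W) (by
        rw [card_sdiff_of_subset (hLB i), card_range, hT i]; omega)
      exact ⟨R, h1, fun _ => h2⟩
    · exact ⟨∅, empty_subset _, fun h' => absurd h' hW⟩
  choose R hRsub hRcard using hR
  let e : ∀ i, Fin (2 * h) ↪o ℕ := fun i => (L i).orderEmbOfFin (hT i)
  have heL : ∀ i k, e i k ∈ L i := fun i k => (L i).orderEmbOfFin_mem (hT i) k
  let D : (Fin m → Fin (2 * h) → Bool) → (Fin m → Fin (2 * h)) → Fin m → ℕ → Bool :=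
    fun l j i p => decide (p ∈ R i (2 * j i + (l i (j i)).toNat) ∨ ∃ k, e i k = p ∧ l i k = true)
  let C : Fin m → ℕ → Bool := fun i p => decide (p ∉ L i)
  have hDL : ∀ l j i k, D l j i (e i k) = l i k := by
    intro l j i k
    have h1 : e i k ∉ R i (2 * j i + (l i (j i)).toNat) := fun h' =>
      (mem_sdiff.1 (hRsub _ _ h')).2 (heL i k)
    simp [D, h1]
  have hDR : ∀ l j i, ∀ p ∉ L i, D l j i p = decide (p ∈ R i (2 * j i + (l i (j i)).toNat)) := by
    intro l j i p hp
    have h1 : ¬ ∃ k, e i k = p ∧ l i k = true := by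
      rintro ⟨k, rfl, -⟩
      exact hp (heL i k)
    simp only [D, h1, or_false]
  have hval : ∀ (b : Fin n → Bool) l' l j j' i,
      (∀ p, ∀ hp : p < B, b ⟨_, (Nat.lt_succ_self _).trans (hlt i hp)⟩ = C i p) →
      (∀ p, ∀ hp : p < B, b ⟨_, hlt i hp⟩ = if p ∈ L i then D l' j' i p else D l j i p) →
      (blockValue b B i = true ↔ l' i (j i) = l i (j i)) := by
    intro b l' l j j' i hbC hbD
    refine blockValue_iff_of_pointer (hLB i) (hT i) ?_ ?_ ?_ ?_
    · have := hlt i (p := B - 1) (by have := (j i).2; omega)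
      omega
    · intro p hp
      rw [bit_of_lt _ ((Nat.lt_succ_self _).trans (hlt i hp)), hbC p hp]
    · intro k
      have hk := mem_range.1 (hLB i (heL i k))
      rw [bit_of_lt _ (hlt i hk), hbD _ hk, if_pos (heL i k)]
      exact hDL l' j' i k
    · rw [← hRcard i (2 * j i + (l i (j i)).toNat)
        (by have := (j i).2; have := Bool.toNat_le (l i (j i)); omega)]
      congr 1
      ext p
      rw [mem_filter]
      constructor
      · rintro ⟨hp, hbit⟩
        obtain ⟨hp1, hp2⟩ := mem_sdiff.1 hp
        rw [mem_range] at hp1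
        rw [bit_of_lt _ (hlt i hp1), hbD p hp1, if_neg hp2, hDR _ _ _ p hp2] at hbit
        exact of_decide_eq_true hbit
      · intro hp
        obtain ⟨hp1, hp2⟩ := mem_sdiff.1 (hRsub _ _ hp)
        refine ⟨hRsub _ _ hp, ?_⟩
        rw [mem_range] at hp1
        rw [bit_of_lt _ (hlt i hp1), hbD p hp1, if_neg hp2, hDR _ _ _ p hp2]
        exact decide_eq_true hp
  refine NBDD.le_of_pointer_family hπ ho hf T (fun l j => blockInput n B C (D l j)) ?_ ?_ ?_
  · intro l j
    rw [blocksValue_iff]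
    intro i hi
    rw [zero_add]
    refine (hval _ l l j j ⟨i, hi⟩ (fun p hp => ?_) fun p hp => ?_).2 rfl
    · exact blockInput_control hp _
    · rw [blockInput_data hp, ite_self]
  · intro l j j' i hj x hx
    unfold blockInput
    split_ifs with h1 h2
    · rfl
    · set i' : Fin m := ⟨_, h1⟩ with hi'
      set p := x.1 / 2 % B with hp
      have hBpos : 0 < B := by
        have := (j i).2
        omega
      have hpB : p < B := Nat.mod_lt _ hBpos
      by_cases hpL : p ∈ L i'
      · obtain ⟨k, hk⟩ : p ∈ Set.range (e i') := by simpa [e] using hpL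
        rw [← hk, hDL, hDL]
      · have hx' : (⟨_, hlt i' hpB⟩ : Fin n) = x := by
          apply Fin.ext
          have := Nat.div_add_mod' (x.1 / 2) B
          have h3 : (i' : ℕ) = x.1 / 2 / B := rfl
          simp only [h3, hp, this]
          omega
        have hTle : T i' ≤ π.symm x := by
          simp only [L, mem_filter, mem_range, hpB, true_and, not_lt, pos, dif_pos, hx'] at hpL
          exact hpL
        rw [hDR _ _ _ _ hpL, hDR _ _ _ _ hpL, hj i' (hTle.trans_lt hx)]
    · rfl
  · intro l j l' j' i htrue
    have hi := blocksValue_iff.1 htrue i i.2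
    rw [zero_add] at hi
    refine (hval _ l' l j j' i (fun p hp => ?_) fun p hp => ?_).1 hi
    · simp only [blockInput_control hp, ite_self]
    · simp only [blockInput_data hp]
      congr 1
      simp [L, hp, pos]

end PointerFamily

theorem NBDD.two_pow_le_of_represents_blocksValue {n m h B : ℕ} (hm : 3 * m ≤ h) (h0 : 0 < h)
    (hmB : 2 * (m * B) ≤ n) (hB : 3 * (2 * h) ≤ B) {G : NBDD n} {π : Equiv.Perm (Fin n)}
    (hπ : G.IsOBDD π) (ho : G.OrNodesFirst) (hf : G.Represents fun b => blocksValue b B 0 m) :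
    2 ^ m ≤ 2 * G.size := by
  have key := NBDD.le_of_represents_blocksValue hmB hB hπ ho hf
  generalize G.size = s at key ⊢
  have key' : 2 ^ m * 2 ^ (2 * h) ≤ s * (m * (s * 2 ^ h) * 2 ^ m + 2 ^ (2 * h)) := by
    refine Nat.le_of_mul_le_mul_left (c := (2 ^ (2 * h)) ^ m * h ^ m) ?_ (by positivity)
    rw [mul_pow 2 h m] at key
    linarith
  rw [mul_add] at key'
  by_contra! hs
  have hsq : 2 * s * (2 * s) ≤ 2 ^ m * 2 ^ m := Nat.mul_le_mul hs.le hs.le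
  have hfirst : 4 * (s * (m * (s * 2 ^ h) * 2 ^ m)) ≤ 2 ^ m * 2 ^ (2 * h) := calc
    4 * (s * (m * (s * 2 ^ h) * 2 ^ m)) = (2 * s * (2 * s)) * m * (2 ^ h * 2 ^ m) := by ring
    _ ≤ (2 ^ m * 2 ^ m) * 2 ^ m * (2 ^ h * 2 ^ m) := by
      gcongr
      exact Nat.lt_two_pow_self.le
    _ = 2 ^ (4 * m + h) := by ring
    _ ≤ 2 ^ (m + 2 * h) := Nat.pow_le_pow_right two_pos (by omega)
    _ = 2 ^ m * 2 ^ (2 * h) := pow_add ..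
  have hsecond : 2 * s * 2 ^ (2 * h) < 2 ^ m * 2 ^ (2 * h) :=
    Nat.mul_lt_mul_of_pos_right hs (by positivity)
  have hpos : 0 < 2 ^ m * 2 ^ (2 * h) := by positivity
  linarith

/-- The number of blocks of the separating function on `n` variables. -/
def blockCount (n : ℕ) : ℕ := Nat.sqrt n / 9

theorem two_mul_blockCount_mul_le (n : ℕ) :
    2 * (blockCount n * (18 * (blockCount n + 1))) ≤ n := by
  have h1 : 9 * blockCount n ≤ Nat.sqrt n := Nat.mul_div_le _ _
  have h2 := Nat.sqrt_le n
  rcases Nat.eq_zero_or_pos (blockCount n) with h0 | h0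
  · simp [h0]
  · nlinarith

theorem sqrt_div_le_blockCount_sub_one {n : ℕ} (hn : 729 ≤ n) :
    1 / 18 * √(n : ℝ) ≤ (blockCount n : ℝ) - 1 := by
  have h1 : 27 ≤ Nat.sqrt n := Nat.le_sqrt.2 hn
  have h2 : (3 : ℝ) ≤ blockCount n := by
    have : 3 ≤ blockCount n := by unfold blockCount; omega
    exact_mod_cast this
  have h3 : Nat.sqrt n + 1 ≤ 9 * (blockCount n + 1) := by unfold blockCount; omega
  have h4 : √(n : ℝ) ≤ 9 * (blockCount n + 1) := by
    refine Real.sqrt_le_iff.2 ⟨by positivity, ?_⟩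
    have h5 : n ≤ (9 * (blockCount n + 1)) ^ 2 :=
      (Nat.lt_succ_sqrt' n).le.trans (Nat.pow_le_pow_left h3 2)
    exact_mod_cast h5
  linarith

/-- There is a sequence `(f_n)` of Boolean functions such
that `f_n` and `¬f_n` are both representable by unambiguous nondeterministic
OBDDs of size polynomial in `n` respecting a common variable ordering, while
every nondeterministic OBDD representing `f_n` in which all nondeterministic
nodes precede all decision nodes has size `2^{Ω(n^ε)}` for some constant
`ε > 0`. -/
theorem statement19 :
    ∃ f : (n : ℕ) → (Fin n → Bool) → Bool,
      (∃ c : ℕ, ∀ n : ℕ, ∃ (π : Equiv.Perm (Fin n)) (F Fb : NBDD n),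
        F.Unambiguous ∧ Fb.Unambiguous ∧ F.IsOBDD π ∧ Fb.IsOBDD π ∧
        F.Represents (f n) ∧ Fb.Represents (fun b => !(f n b)) ∧
        F.size ≤ (n + 2) ^ c ∧ Fb.size ≤ (n + 2) ^ c) ∧
      (∃ ε : ℝ, 0 < ε ∧ ∃ d : ℝ, 0 < d ∧ ∃ n₀ : ℕ, ∀ n : ℕ, n₀ ≤ n →
        ∀ (G : NBDD n) (π : Equiv.Perm (Fin n)),
          G.IsOBDD π → G.OrNodesFirst → G.Represents (f n) →
          (2 : ℝ) ^ (d * (n : ℝ) ^ ε) ≤ (G.size : ℝ)) := by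
  refine ⟨fun n b => blocksValue b (18 * (blockCount n + 1)) 0 (blockCount n), ⟨9, fun n => ?_⟩,
    1 / 2, by norm_num, 1 / 18, by norm_num, 729, fun n hn G π hπ ho hf => ?_⟩
  · have hle := two_mul_blockCount_mul_le n
    have hB : 0 < 18 * (blockCount n + 1) := by positivity
    refine ⟨1, (blockMachine _ _ hle true).toNBDD, (blockMachine _ _ hle false).toNBDD,
      blockMachine_unambiguous, blockMachine_unambiguous, Machine.isOBDD_toNBDD _,
      Machine.isOBDD_toNBDD _, fun b => (blockMachine_accepts hB).symm,
      fun b => ?_, blockMachine_size_le, blockMachine_size_le⟩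
    rw [blockMachine_accepts hB, Bool.not_eq_true']
  · have hpow := NBDD.two_pow_le_of_represents_blocksValue (h := 3 * (blockCount n + 1))
      (by omega) (by omega) (two_mul_blockCount_mul_le n) (by omega) hπ ho hf
    rw [← Real.sqrt_eq_rpow]
    calc (2 : ℝ) ^ (1 / 18 * √(n : ℝ)) ≤ 2 ^ ((blockCount n : ℝ) - 1) :=
          Real.rpow_le_rpow_of_exponent_le one_le_two (sqrt_div_le_blockCount_sub_one hn)
      _ = 2 ^ blockCount n / 2 := by rw [Real.rpow_sub_one two_ne_zero, Real.rpow_natCast]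
      _ ≤ G.size := by
          rw [div_le_iff₀' two_pos]
          exact_mod_cast hpow

end BDDPaper
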